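/- arXiv:2304.10925 — 3 statements merged into one kernel-verified Lean document; each statement's English description precedes it below -/
import Mathlib

section
/- If γ = 0 and γ_j ≠ 0 for some j ∈ {1, …, m}, then the image of F equals (L_n)^{m+1}, the span of {e_{m+1}, …, e_n}. -/
/-- The multiplication of the `n`-dimensional null-filiform Leibniz algebra `L_n`,
realized on coordinate vectors `Fin n → K`: the bilinear map determined by
`e_i · e_1 = e_{i+1}` for `1 ≤ i ≤ n-1` and all other products of basis vectors zero. -/
def nfMul (K : Type*) [Field K] (n : ℕ) (x y : Fin n → K) : Fin n → K :=
  fun k => if (k : ℕ) = 0 then 0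
    else y ⟨0, Nat.lt_of_le_of_lt (Nat.zero_le _) k.isLt⟩ *
         x ⟨(k : ℕ) - 1, Nat.lt_of_le_of_lt (Nat.sub_le _ _) k.isLt⟩

/-- The left-normed product `a₁a₂⋯a_k = (⋯((a₁a₂)a₃)⋯)a_k` of a list of elements
of `L_n` (junk value `0` for the empty list). -/
def lnProd (K : Type*) [Field K] (n : ℕ) : List (Fin n → K) → (Fin n → K)
  | [] => 0
  | a :: t => t.foldl (nfMul K n) a

/-- The span of the basis vectors `e_k, …, e_n` of `L_n`; this is `{0}` when `k > n`. -/
def nfPow (K : Type*) [Field K] (n k : ℕ) : Submodule K (Fin n → K) :=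
  Submodule.span K {x | ∃ i : Fin n, k ≤ (i : ℕ) + 1 ∧ x = Pi.single i (1 : K)}

/-- The multilinear map `F(v₁, …, v_m) = Σ_{σ ∈ S_m} α_σ · v_{σ(1)}v_{σ(2)}⋯v_{σ(m)}`
(left-normed products) on `L_n`, attached to a family of scalars `α_σ` indexed by
permutations of `{1, …, m}`. -/
noncomputable def multF (K : Type*) [Field K] (n m : ℕ)
    (α : Equiv.Perm (Fin m) → K) (v : Fin m → (Fin n → K)) : Fin n → K :=
  ∑ σ : Equiv.Perm (Fin m), α σ • lnProd K n (List.ofFn fun i => v (σ i))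

theorem nf_foldl (K : Type*) [Field K] (n : ℕ) (hn : 0 < n) (t : List (Fin n → K)) :
    ∀ (a : Fin n → K) (k : Fin n), t.foldl (nfMul K n) a k =
      if (k : ℕ) < t.length then 0
      else (t.map (fun y => y ⟨0, hn⟩)).prod *
        a ⟨(k : ℕ) - t.length, Nat.lt_of_le_of_lt (Nat.sub_le _ _) k.isLt⟩ := by
  induction t with
  | nil => intro a k; simp
  | cons y t ih =>
    intro a k
    rw [List.foldl_cons, ih]
    simp only [List.length_cons, List.map_cons, List.prod_cons, nfMul]
    by_cases h1 : (k : ℕ) < t.length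
    · rw [if_pos h1, if_pos (by omega)]
    · rw [if_neg h1]
      by_cases h2 : (k : ℕ) < t.length + 1
      · rw [if_pos h2, if_pos (by omega), mul_zero]
      · rw [if_neg h2, if_neg (by omega)]
        simp only [Nat.sub_sub]
        ring

theorem nf_mem_pow (K : Type*) [Field K] (n k : ℕ) (x : Fin n → K) :
    x ∈ nfPow K n k ↔ ∀ i : Fin n, (i : ℕ) + 1 < k → x i = 0 := by
  constructor
  · intro hx i hi
    unfold nfPow at hx
    induction hx using Submodule.span_induction with
    | mem x hx =>
      obtain ⟨l, hl, rfl⟩ := hx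
      refine Pi.single_eq_of_ne ?_ _
      rintro rfl
      omega
    | zero => rfl
    | add x y _ _ h1 h2 => simp [h1, h2]
    | smul a x _ h => simp [h]
  · intro h
    rw [pi_eq_sum_univ' x]
    refine Submodule.sum_mem _ fun i _ => ?_
    by_cases hi : (i : ℕ) + 1 < k
    · rw [h i hi, zero_smul]; exact Submodule.zero_mem _
    · refine Submodule.smul_mem _ _ (Submodule.subset_span ⟨i, by omega, ?_⟩)
      ext l
      simp [Pi.single_apply, eq_comm]

theorem multF_apply (K : Type*) [Field K] (n m : ℕ) (hn : 0 < n)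
    (α : Equiv.Perm (Fin (m + 1)) → K) (v : Fin (m + 1) → (Fin n → K)) (k : Fin n) :
    multF K n (m + 1) α v k = if (k : ℕ) < m then 0 else
      ∑ σ : Equiv.Perm (Fin (m + 1)), α σ * ((∏ i : Fin m, v (σ i.succ) ⟨0, hn⟩) *
        v (σ 0) ⟨(k : ℕ) - m, Nat.lt_of_le_of_lt (Nat.sub_le _ _) k.isLt⟩) := by
  unfold multF
  simp only [Finset.sum_apply, Pi.smul_apply, smul_eq_mul, List.ofFn_succ, lnProd,
    nf_foldl K n hn, List.length_ofFn, List.map_ofFn, List.prod_ofFn, Function.comp_def]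
  split_ifs <;> simp

/-- If `γ = Σ_{σ ∈ S_m} α_σ = 0` and `γ_j = Σ_{σ(1)=j} α_σ ≠ 0` for some
`j ∈ {1, …, m}`, then the image of `F` equals `(L_n)^{m+1}`, the span of
`{e_{m+1}, …, e_n}`. -/
theorem Ln_multilinear_image_gamma_zero (K : Type*) [Field K] (n m : ℕ)
    (hn : 1 ≤ n) (hm : 1 ≤ m) (α : Equiv.Perm (Fin m) → K)
    (hγ : ∑ σ : Equiv.Perm (Fin m), α σ = 0) (j : Fin m)
    (hj : ∑ σ ∈ Finset.univ.filter (fun σ : Equiv.Perm (Fin m) => σ ⟨0, hm⟩ = j),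
        α σ ≠ 0) :
    Set.range (multF K n m α) = (nfPow K n (m + 1) : Set (Fin n → K)) := by
  obtain ⟨m, rfl⟩ : ∃ M, m = M + 1 := ⟨m - 1, by omega⟩
  have hj' : ∑ σ ∈ Finset.univ.filter (fun σ : Equiv.Perm (Fin (m + 1)) => σ 0 = j),
        α σ ≠ 0 := hj
  clear hj
  set g := ∑ σ ∈ Finset.univ.filter (fun σ : Equiv.Perm (Fin (m + 1)) => σ 0 = j),
        α σ with hg
  ext w
  rw [SetLike.mem_coe, nf_mem_pow]
  constructor
  · rintro ⟨v, rfl⟩ k hk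
    rw [multF_apply K n m hn]
    split_ifs with h
    · rfl
    · have hkm : (k : ℕ) - m = 0 := by omega
      simp only [hkm]
      have : ∀ σ : Equiv.Perm (Fin (m + 1)),
          (∏ i : Fin m, v (σ i.succ) ⟨0, hn⟩) * v (σ 0) ⟨0, hn⟩ =
            ∏ i, v i ⟨0, hn⟩ := by
        intro σ
        rw [← Equiv.prod_comp σ (fun i => v i ⟨0, hn⟩), Fin.prod_univ_succ, mul_comm]
      simp only [this, ← Finset.sum_mul, hγ, zero_mul]
  · intro hw
    refine ⟨fun i l => if (l : ℕ) = 0 then 1 else if i = j then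
      (if h : (l : ℕ) + m < n then g⁻¹ * w ⟨l + m, h⟩ else 0) else 0, ?_⟩
    ext k
    rw [multF_apply K n m hn]
    by_cases h : (k : ℕ) < m
    · rw [if_pos h]; exact (hw k (by omega)).symm
    · rw [if_neg h]
      by_cases h0 : (k : ℕ) - m = 0
      · simp [h0, hγ, hw k (by omega)]
      · have hk : (k : ℕ) - m + m = k := by omega
        simp only [if_true, Finset.prod_const_one, one_mul, if_neg h0, hk, k.isLt, dif_pos,
          Fin.eta, mul_ite, mul_zero]
        rw [← Finset.sum_filter, ← Finset.sum_mul, ← hg, mul_inv_cancel_left₀ hj']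
end

section
/- Suppose K is algebraically closed, F is not identically zero on L_n, and α_1 + ⋯ + α_m ≠ 0. Then the image of F contains the set {0} ∪ {c·e_d + u : c ∈ K, c ≠ 0, u ∈ (L_n)^{d+1}}. -/
/-- `rpow K n a b s` is the left-normed product `a·b^{(s)} = ((⋯((a·b)·b)⋯)·b)` with
`s` factors `b`. -/
def rpow (K : Type*) [Field K] (n : ℕ) (a b : Fin n → K) (s : ℕ) : Fin n → K :=
  (fun t => nfMul K n t b)^[s] a

/-- The basis vector `e_d` of `L_n` (`1`-indexed), interpreted as `0` when `d > n`
or `d = 0`. -/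
def eVec (K : Type*) [Field K] (n d : ℕ) : Fin n → K :=
  fun k => if (k : ℕ) + 1 = d then 1 else 0

/-- The map
`F(v₁, …, v_m) = Σ_{j=1}^m α_j · v_j v₁^{(d₁)} ⋯ v_{j−1}^{(d_{j−1})} v_j^{(d_j−1)} v_{j+1}^{(d_{j+1})} ⋯ v_m^{(d_m)}`
(left-normed products) on `L_n`: the general multihomogeneous polynomial of
multidegree `(d₁, …, d_m)` reduced modulo the polynomial identities of `L_n`. -/
noncomputable def homF (K : Type*) [Field K] (n m : ℕ) (d : Fin m → ℕ)
    (α : Fin m → K) (v : Fin m → (Fin n → K)) : Fin n → K :=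
  ∑ j : Fin m, α j •
    (List.finRange m).foldl
      (fun acc l => rpow K n acc (v l) (if l = j then d l - 1 else d l)) (v j)

theorem foldl_rpow_const (K : Type*) [Field K] (n : ℕ) {ι : Type*} (v : Fin n → K)
    (s : ι → ℕ) (L : List ι) (a : Fin n → K) :
    L.foldl (fun acc l => rpow K n acc v (s l)) a = rpow K n a v (L.map s).sum := by
  induction L generalizing a with
  | nil => simp [rpow]
  | cons x L ih =>
    simp only [List.foldl_cons, List.map_cons, List.sum_cons]
    rw [ih]
    simp only [rpow]
    rw [← Function.iterate_add_apply, Nat.add_comm]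

theorem rpow_apply (K : Type*) [Field K] (n : ℕ) (hn : 0 < n) (a b : Fin n → K) (s : ℕ)
    (k : Fin n) :
    rpow K n a b s k = if (k : ℕ) < s then 0
      else b ⟨0, hn⟩ ^ s * a ⟨(k : ℕ) - s, Nat.lt_of_le_of_lt (Nat.sub_le _ _) k.isLt⟩ := by
  induction s generalizing k with
  | zero => simp [rpow]
  | succ s ih =>
    have h : rpow K n a b (s + 1) = nfMul K n (rpow K n a b s) b := by
      simp only [rpow, Function.iterate_succ_apply']
    rw [h]
    simp only [nfMul, ih]
    by_cases h0 : (k : ℕ) = 0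
    · simp [h0]
    · by_cases h1 : (k : ℕ) < s + 1
      · have h2 : (k : ℕ) - 1 < s := by omega
        simp [h0, h1, h2]
      · have h2 : ¬ (k : ℕ) - 1 < s := by omega
        have h3 : (k : ℕ) - 1 - s = k - (s + 1) := by omega
        simp only [h0, h1, h2, h3, if_false]
        ring

theorem homF_const (K : Type*) [Field K] (n m : ℕ) (d : Fin m → ℕ) (hd : ∀ j, 1 ≤ d j)
    (α : Fin m → K) (v : Fin n → K) :
    homF K n m d α (fun _ => v) = (∑ j, α j) • rpow K n v v ((∑ j, d j) - 1) := by
  unfold homF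
  rw [Finset.sum_smul]
  refine Finset.sum_congr rfl fun j _ => ?_
  rw [foldl_rpow_const K n v (fun l => if l = j then d l - 1 else d l)]
  congr 2
  rw [← Fin.sum_univ_def]
  have h : ∑ l, d l = ∑ l, ((if l = j then d l - 1 else d l) + if l = j then 1 else 0) := by
    refine Finset.sum_congr rfl fun l _ => ?_
    have := hd l
    split_ifs <;> omega
  rw [h, Finset.sum_add_distrib]
  simp

theorem nfPow_apply_eq_zero (K : Type*) [Field K] (n k : ℕ) (u : Fin n → K)
    (hu : u ∈ nfPow K n k) (i : Fin n) (hi : (i : ℕ) + 1 < k) : u i = 0 := by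
  unfold nfPow at hu
  induction hu using Submodule.span_induction with
  | mem x hx =>
    obtain ⟨j, hj, rfl⟩ := hx
    rw [Pi.single_apply, if_neg]
    rintro rfl
    omega
  | zero => rfl
  | add x y _ _ hx hy => simp [hx, hy]
  | smul a x _ hx => simp [hx]

/-- Suppose `K` is algebraically closed, the multihomogeneous map `F` (of multidegree
`(d₁, …, d_m)`, each `d_j ≥ 1`, with `d = d₁ + ⋯ + d_m`) is not identically zero on
`L_n`, and `α₁ + ⋯ + α_m ≠ 0`.  Then the image of `F` contains
`{0} ∪ {c·e_d + u : c ∈ K, c ≠ 0, u ∈ (L_n)^{d+1}}`. -/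
theorem Ln_homogeneous_image_sum_nonzero (K : Type*) [Field K] [IsAlgClosed K]
    (n m : ℕ) (hn : 1 ≤ n) (hm : 1 ≤ m) (d : Fin m → ℕ) (hd : ∀ j, 1 ≤ d j)
    (α : Fin m → K)
    (hne : ∃ v : Fin m → (Fin n → K), homF K n m d α v ≠ 0)
    (hα : ∑ j : Fin m, α j ≠ 0) :
    ({0} : Set (Fin n → K)) ∪
      {w | ∃ c : K, c ≠ 0 ∧ ∃ u ∈ nfPow K n ((∑ j : Fin m, d j) + 1),
        w = c • eVec K n (∑ j : Fin m, d j) + u}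
      ⊆ Set.range (homF K n m d α) := by
  have hD : 1 ≤ ∑ j, d j :=
    (hd ⟨0, hm⟩).trans (Finset.single_le_sum (fun _ _ => Nat.zero_le _) (Finset.mem_univ _))
  generalize hDe : ∑ j, d j = D at *
  rintro w (hw | ⟨c, hc, u, hu, rfl⟩)
  · refine ⟨fun _ => 0, ?_⟩
    rw [Set.mem_singleton_iff.1 hw, homF_const K n m d hd]
    ext k
    simp [rpow_apply K n hn]
  · obtain ⟨a, ha⟩ := IsAlgClosed.exists_pow_nat_eq (c / ∑ j, α j) hD
    have ha0 : a ≠ 0 := by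
      rintro rfl
      rw [zero_pow (by omega)] at ha
      exact div_ne_zero hc hα ha.symm
    refine ⟨fun _ => fun i => if (i : ℕ) = 0 then a else
      if h : (i : ℕ) + (D - 1) < n then u ⟨i + (D - 1), h⟩ / ((∑ j, α j) * a ^ (D - 1)) else 0, ?_⟩
    rw [homF_const K n m d hd, hDe]
    ext k
    simp only [Pi.smul_apply, Pi.add_apply, smul_eq_mul, rpow_apply K n hn, eVec, if_true]
    by_cases h1 : (k : ℕ) < D - 1
    · rw [nfPow_apply_eq_zero K n _ u hu k (by omega)]
      have h2 : (k : ℕ) + 1 ≠ D := by omega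
      simp [h1, h2]
    · by_cases h2 : (k : ℕ) + 1 = D
      · rw [nfPow_apply_eq_zero K n _ u hu k (by omega)]
        have h3 : (k : ℕ) - (D - 1) = 0 := by omega
        simp only [h1, h2, h3, if_true, if_false]
        rw [← pow_succ, Nat.sub_add_cancel hD, ha]
        field_simp
        simp
      · have h3 : (k : ℕ) - (D - 1) ≠ 0 := by omega
        have h4 : (k : ℕ) - (D - 1) + (D - 1) = k := by omega
        simp only [h1, h2, h3, h4, if_false, k.isLt, dif_pos]
        field_simp
        simp
end

section
/- Suppose K is algebraically closed. Then: (1) if F is identically zero on L_n, its image is {0}; (2) if F is not identically zero and α_1 + ⋯ + α_m = 0, then the image of F equals (L_n)^{d+1}; (3) if F is not identically zero and α_1 + ⋯ + α_m ≠ 0, then: (a) if there exists j with d_j = 1 and α_j ≠ 0, the image of F equals (L_n)^d; (b) if α_j = 0 for every j with d_j = 1, the image of F equals {0} ∪ {c·e_d + u : c ∈ K, c ≠ 0, u ∈ (L_n)^{d+1}}. -/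
theorem mem_nfPow_iff (K : Type*) [Field K] (n k : ℕ) (w : Fin n → K) :
    w ∈ nfPow K n k ↔ ∀ i : Fin n, (i : ℕ) + 1 < k → w i = 0 := by
  constructor
  · intro hw i hi
    unfold nfPow at hw
    induction hw using Submodule.span_induction with
    | mem x hx =>
      obtain ⟨j, hj, rfl⟩ := hx
      have : i ≠ j := by rintro rfl; omega
      simp [this]
    | zero => rfl
    | add x y _ _ hx hy => simp [hx, hy]
    | smul a x _ hx => simp [hx]
  · intro h
    rw [pi_eq_sum_univ' w]
    refine Submodule.sum_mem _ fun i _ => ?_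
    by_cases hi : (i : ℕ) + 1 < k
    · rw [h i hi]; simp
    · refine Submodule.smul_mem _ _ (Submodule.subset_span ⟨i, by omega, ?_⟩)
      ext j
      simp [Pi.single_apply, eq_comm]

theorem foldl_rpow_apply (K : Type*) [Field K] (n m : ℕ) (hn : 0 < n) (v : Fin m → Fin n → K)
    (s : Fin m → ℕ) (L : List (Fin m)) (a : Fin n → K) (k : Fin n) :
    L.foldl (fun acc l => rpow K n acc (v l) (s l)) a k =
      if (k : ℕ) < (L.map s).sum then 0
      else (L.map fun l => v l ⟨0, hn⟩ ^ s l).prod *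
        a ⟨(k : ℕ) - (L.map s).sum, Nat.lt_of_le_of_lt (Nat.sub_le _ _) k.isLt⟩ := by
  induction L generalizing a with
  | nil => simp
  | cons l L ih =>
    rw [List.foldl_cons, ih]
    simp only [List.map_cons, List.sum_cons, List.prod_cons]
    by_cases h1 : (k : ℕ) < (L.map s).sum
    · rw [if_pos h1, if_pos (by omega)]
    · rw [if_neg h1, rpow_apply K n hn]
      by_cases h2 : (k : ℕ) < s l + (L.map s).sum
      · rw [if_pos h2, if_pos (by simp only; omega), mul_zero]
      · rw [if_neg h2, if_neg (by simp only; omega)]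
        have h3 : (k : ℕ) - (L.map s).sum - s l = k - (s l + (L.map s).sum) := by omega
        simp only [h3]
        ring

/-- The monomial multiplying `v_j` in the `j`-th summand. -/
def coefP {K : Type*} [Field K] {m : ℕ} (d : Fin m → ℕ) (x : Fin m → K) (j : Fin m) : K :=
  ∏ l, x l ^ (if l = j then d l - 1 else d l)

theorem coefP_mul {K : Type*} [Field K] {m : ℕ} (d : Fin m → ℕ) (hd : ∀ j, 1 ≤ d j)
    (x : Fin m → K) (j : Fin m) : coefP d x j * x j = ∏ l, x l ^ d l := by
  unfold coefP
  rw [← Finset.mul_prod_erase _ _ (Finset.mem_univ j),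
    ← Finset.mul_prod_erase (Finset.univ) (fun l => x l ^ d l) (Finset.mem_univ j)]
  have h : ∏ l ∈ Finset.univ.erase j, x l ^ (if l = j then d l - 1 else d l)
      = ∏ l ∈ Finset.univ.erase j, x l ^ d l := by
    refine Finset.prod_congr rfl fun l hl => ?_
    rw [if_neg (Finset.ne_of_mem_erase hl)]
  rw [h, if_pos rfl]
  obtain ⟨e, he⟩ : ∃ e, d j = e + 1 := ⟨d j - 1, by have := hd j; omega⟩
  rw [he]
  simp only [Nat.add_sub_cancel]
  ring

theorem sum_sub_one {m : ℕ} (d : Fin m → ℕ) (hd : ∀ j, 1 ≤ d j) (j : Fin m) :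
    (∑ l, if l = j then d l - 1 else d l) + 1 = ∑ l, d l := by
  rw [← Finset.add_sum_erase _ _ (Finset.mem_univ j),
    ← Finset.add_sum_erase (Finset.univ) (fun l => d l) (Finset.mem_univ j)]
  have h : ∑ l ∈ Finset.univ.erase j, (if l = j then d l - 1 else d l)
      = ∑ l ∈ Finset.univ.erase j, d l := by
    refine Finset.sum_congr rfl fun l hl => ?_
    rw [if_neg (Finset.ne_of_mem_erase hl)]
  rw [h, if_pos rfl]
  have := hd j
  omega

theorem homF_apply (K : Type*) [Field K] (n m : ℕ) (hn : 0 < n) (d : Fin m → ℕ)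
    (hd : ∀ j, 1 ≤ d j) (α : Fin m → K) (v : Fin m → Fin n → K) (k : Fin n) (t : Fin n)
    (ht : (k : ℕ) + 1 = t + ∑ j, d j) :
    homF K n m d α v k = ∑ j, α j * (coefP d (fun l => v l ⟨0, hn⟩) j * v j t) := by
  unfold homF
  rw [Finset.sum_apply]
  refine Finset.sum_congr rfl fun j _ => ?_
  rw [Pi.smul_apply, smul_eq_mul,
    foldl_rpow_apply K n m hn v (fun l => if l = j then d l - 1 else d l)]
  have h := sum_sub_one d hd j
  rw [← Fin.sum_univ_def, ← Fin.prod_univ_def, if_neg (by omega)]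
  congr 3
  ext
  simp only
  omega

theorem homF_apply_low (K : Type*) [Field K] (n m : ℕ) (hn : 0 < n) (d : Fin m → ℕ)
    (hd : ∀ j, 1 ≤ d j) (α : Fin m → K) (v : Fin m → Fin n → K) (k : Fin n)
    (hk : (k : ℕ) + 1 < ∑ j, d j) : homF K n m d α v k = 0 := by
  unfold homF
  rw [Finset.sum_apply]
  refine Finset.sum_eq_zero fun j _ => ?_
  rw [Pi.smul_apply, smul_eq_mul,
    foldl_rpow_apply K n m hn v (fun l => if l = j then d l - 1 else d l)]
  have h := sum_sub_one d hd j
  rw [← Fin.sum_univ_def, if_pos (by omega), mul_zero]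

theorem homF_apply_mid (K : Type*) [Field K] (n m : ℕ) (hn : 0 < n) (d : Fin m → ℕ)
    (hd : ∀ j, 1 ≤ d j) (α : Fin m → K) (v : Fin m → Fin n → K) (k : Fin n)
    (hk : (k : ℕ) + 1 = ∑ j, d j) :
    homF K n m d α v k = (∑ j, α j) * ∏ l, v l ⟨0, hn⟩ ^ d l := by
  rw [homF_apply K n m hn d hd α v k ⟨0, hn⟩ (by simpa using hk), Finset.sum_mul]
  refine Finset.sum_congr rfl fun j _ => ?_
  rw [← coefP_mul d hd (fun l => v l ⟨0, hn⟩) j]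

theorem homF_surj (K : Type*) [Field K] (n m : ℕ) (hn : 0 < n) (d : Fin m → ℕ)
    (hd : ∀ j, 1 ≤ d j) (α : Fin m → K) (x : Fin m → K) (j : Fin m) (hα : α j ≠ 0)
    (hP : coefP d x j ≠ 0) (w : Fin n → K)
    (hlow : ∀ k : Fin n, (k : ℕ) + 1 < ∑ j, d j → w k = 0)
    (hmid : ∀ k : Fin n, (k : ℕ) + 1 = ∑ j, d j → w k = (∑ j, α j) * ∏ l, x l ^ d l) :
    w ∈ Set.range (homF K n m d α) := by
  let v : Fin m → Fin n → K := fun l i => if (i : ℕ) = 0 then x l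
    else if l = j then
      (if h : (i : ℕ) + (∑ j, d j) - 1 < n then w ⟨(i : ℕ) + (∑ j, d j) - 1, h⟩ else 0)
        / (α j * coefP d x j)
    else 0
  have hx : (fun l => v l ⟨0, hn⟩) = x := by ext l; simp [v]
  refine ⟨v, ?_⟩
  ext k
  rcases lt_trichotomy ((k : ℕ) + 1) (∑ j, d j) with h | h | h
  · rw [hlow k h, homF_apply_low K n m hn d hd α v k h]
  · rw [hmid k h, homF_apply_mid K n m hn d hd α v k h, ← hx]
  · have hd1 : 1 ≤ ∑ j, d j :=
      (hd j).trans (Finset.single_le_sum (f := d) (fun _ _ => Nat.zero_le _) (Finset.mem_univ j))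
    rw [homF_apply K n m hn d hd α v k ⟨(k : ℕ) + 1 - ∑ j, d j, by omega⟩ (by simp only; omega), hx]
    have ht : (k : ℕ) + 1 - ∑ j, d j ≠ 0 := by omega
    have ht2 : (k : ℕ) + 1 - (∑ j, d j) + (∑ j, d j) - 1 = k := by omega
    rw [Finset.sum_eq_single j]
    · simp only [v, ht, ht2, if_false, if_true, k.isLt, dif_pos]
      field_simp
    · intro l _ hl
      simp [v, ht, hl]
    · simp

theorem exists_ne_of_homF_ne (K : Type*) [Field K] (n m : ℕ) (d : Fin m → ℕ)
    (α : Fin m → K) (h : ∃ v : Fin m → (Fin n → K), homF K n m d α v ≠ 0) :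
    ∃ j, α j ≠ 0 := by
  by_contra! hc
  obtain ⟨v, hv⟩ := h
  exact hv (by simp [homF, hc])

/-- Complete description of the image of a multihomogeneous polynomial map `F` (of
multidegree `(d₁, …, d_m)`, each `d_j ≥ 1`, with `d = d₁ + ⋯ + d_m`) on `L_n` over an
algebraically closed field `K`:
(1) if `F` is identically zero, its image is `{0}`;
(2) if `F` is not identically zero and `α₁ + ⋯ + α_m = 0`, its image is `(L_n)^{d+1}`;
(3) if `F` is not identically zero and `α₁ + ⋯ + α_m ≠ 0`, then
  (a) if `d_j = 1` and `α_j ≠ 0` for some `j`, its image is `(L_n)^d`;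
  (b) if `α_j = 0` for every `j` with `d_j = 1`, its image is
      `{0} ∪ {c·e_d + u : c ∈ K, c ≠ 0, u ∈ (L_n)^{d+1}}`. -/
theorem Ln_homogeneous_image_description (K : Type*) [Field K] [IsAlgClosed K]
    (n m : ℕ) (hn : 1 ≤ n) (hm : 1 ≤ m) (d : Fin m → ℕ) (hd : ∀ j, 1 ≤ d j)
    (α : Fin m → K) :
    ((∀ v : Fin m → (Fin n → K), homF K n m d α v = 0) →
      Set.range (homF K n m d α) = ({0} : Set (Fin n → K))) ∧
    ((∃ v : Fin m → (Fin n → K), homF K n m d α v ≠ 0) →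
      (∑ j : Fin m, α j = 0) →
      Set.range (homF K n m d α)
        = (nfPow K n ((∑ j : Fin m, d j) + 1) : Set (Fin n → K))) ∧
    ((∃ v : Fin m → (Fin n → K), homF K n m d α v ≠ 0) →
      (∑ j : Fin m, α j ≠ 0) →
      ((∃ j : Fin m, d j = 1 ∧ α j ≠ 0) →
        Set.range (homF K n m d α)
          = (nfPow K n (∑ j : Fin m, d j) : Set (Fin n → K))) ∧
      ((∀ j : Fin m, d j = 1 → α j = 0) →
        Set.range (homF K n m d α)
          = ({0} : Set (Fin n → K)) ∪
            {w | ∃ c : K, c ≠ 0 ∧ ∃ u ∈ nfPow K n ((∑ j : Fin m, d j) + 1),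
              w = c • eVec K n (∑ j : Fin m, d j) + u})) := by
  have hn0 : 0 < n := hn
  refine ⟨fun h => ?_, fun hF hs => ?_, fun hF hs => ⟨fun hj => ?_, fun hj => ?_⟩⟩
  · ext w
    constructor
    · rintro ⟨v, rfl⟩
      exact h v
    · intro hw
      exact ⟨0, by rw [h, Set.mem_singleton_iff.1 hw]⟩
  · obtain ⟨j, hα⟩ := exists_ne_of_homF_ne K n m d α hF
    ext w
    rw [SetLike.mem_coe, mem_nfPow_iff]
    constructor
    · rintro ⟨v, rfl⟩ k hk
      rcases Nat.lt_succ_iff_lt_or_eq.1 hk with h | h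
      · exact homF_apply_low K n m hn0 d hd α v k h
      · rw [homF_apply_mid K n m hn0 d hd α v k h, hs, zero_mul]
    · intro hw
      refine homF_surj K n m hn0 d hd α (fun _ => 1) j hα (by simp [coefP]) w
        (fun k hk => hw k (by omega)) (fun k hk => ?_)
      rw [hw k (by omega), hs, zero_mul]
  · obtain ⟨j, hdj, hα⟩ := hj
    ext w
    rw [SetLike.mem_coe, mem_nfPow_iff]
    constructor
    · rintro ⟨v, rfl⟩ k hk
      exact homF_apply_low K n m hn0 d hd α v k hk
    · intro hw
      obtain ⟨c, hc⟩ : ∃ c : K, ∀ k : Fin n, (k : ℕ) + 1 = ∑ j, d j → w k = c := by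
        by_cases h : ∃ k : Fin n, (k : ℕ) + 1 = ∑ j, d j
        · obtain ⟨k, hk⟩ := h
          refine ⟨w k, fun k' hk' => ?_⟩
          congr 1
          ext
          omega
        · exact ⟨0, fun k hk => absurd ⟨k, hk⟩ h⟩
      have hP : coefP d (fun l => if l = j then c / ∑ j, α j else 1) j = 1 := by
        refine Finset.prod_eq_one fun l _ => ?_
        by_cases hl : l = j
        · subst hl; simp [hdj]
        · simp [hl]
      refine homF_surj K n m hn0 d hd α _ j hα (by rw [hP]; exact one_ne_zero) w hw
        (fun k hk => ?_)
      rw [← coefP_mul d hd _ j, hP, hc k hk]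
      simp only [if_true]
      field_simp
  · obtain ⟨j, hα⟩ := exists_ne_of_homF_ne K n m d α hF
    ext w
    constructor
    · rintro ⟨v, rfl⟩
      by_cases hx : ∃ l, v l ⟨0, hn0⟩ = 0
      · left
        obtain ⟨l, hl⟩ := hx
        rw [Set.mem_singleton_iff]
        ext k
        by_cases hk : (k : ℕ) + 1 < ∑ j, d j
        · exact homF_apply_low K n m hn0 d hd α v k hk
        · have hd1 : 1 ≤ ∑ j, d j :=
            (hd j).trans
              (Finset.single_le_sum (f := d) (fun _ _ => Nat.zero_le _) (Finset.mem_univ j))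
          rw [homF_apply K n m hn0 d hd α v k ⟨(k : ℕ) + 1 - ∑ j, d j, by omega⟩
            (by simp only; omega)]
          refine Finset.sum_eq_zero fun i _ => ?_
          by_cases hi : d i = 1
          · rw [hj i hi, zero_mul]
          · have : coefP d (fun l => v l ⟨0, hn0⟩) i = 0 := by
              refine Finset.prod_eq_zero (Finset.mem_univ l) ?_
              simp only [hl]
              refine zero_pow ?_
              have := hd i
              have := hd l
              split_ifs with h
              · subst h; omega
              · omega
            rw [this, zero_mul, mul_zero]
      · right
        push Not at hx
        refine ⟨(∑ j, α j) * ∏ l, v l ⟨0, hn0⟩ ^ d l,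
          mul_ne_zero hs (Finset.prod_ne_zero_iff.2 fun l _ => pow_ne_zero _ (hx l)),
          homF K n m d α v -
            ((∑ j, α j) * ∏ l, v l ⟨0, hn0⟩ ^ d l) • eVec K n (∑ j, d j), ?_, by abel⟩
        rw [mem_nfPow_iff]
        intro k hk
        rcases Nat.lt_succ_iff_lt_or_eq.1 hk with h | h
        · simp [homF_apply_low K n m hn0 d hd α v k h, eVec, h.ne]
        · simp [homF_apply_mid K n m hn0 d hd α v k h, eVec, h]
    · rintro (hw | ⟨c, hc, u, hu, rfl⟩)
      · rw [Set.mem_singleton_iff] at hw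
        subst hw
        refine ⟨0, ?_⟩
        ext k
        by_cases hk : (k : ℕ) + 1 < ∑ j, d j
        · exact homF_apply_low K n m hn0 d hd α 0 k hk
        · have hd1 : 1 ≤ ∑ j, d j :=
            (hd j).trans
              (Finset.single_le_sum (f := d) (fun _ _ => Nat.zero_le _) (Finset.mem_univ j))
          rw [homF_apply K n m hn0 d hd α 0 k ⟨(k : ℕ) + 1 - ∑ j, d j, by omega⟩
            (by simp only; omega)]
          simp
      · rw [mem_nfPow_iff] at hu
        have hdj : 0 < d j := hd j
        obtain ⟨z, hz⟩ := IsAlgClosed.exists_pow_nat_eq (c / ∑ j, α j) hdj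
        have hz0 : z ≠ 0 := by
          rintro rfl
          rw [zero_pow hdj.ne'] at hz
          exact div_ne_zero hc hs hz.symm
        have hprod : ∏ l, (if l = j then z else 1) ^ d l = c / ∑ j, α j := by
          rw [Finset.prod_eq_single j, if_pos rfl, hz]
          · intro l _ hl
            simp [hl]
          · simp
        refine homF_surj K n m hn0 d hd α (fun l => if l = j then z else 1) j hα ?_ _
          (fun k hk => ?_) (fun k hk => ?_)
        · refine Finset.prod_ne_zero_iff.2 fun l _ => pow_ne_zero _ ?_
          beta_reduce
          split_ifs
          · exact hz0
          · exact one_ne_zero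
        · simp [eVec, hk.ne, hu k (by omega)]
        · rw [hprod]
          simp only [Pi.add_apply, Pi.smul_apply, eVec, hk, if_true, hu k (by omega)]
          field_simp
          simp
end
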